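/- Let p > 2, q > 1, T > 0 and n ∈ ℕ (n ≥ 1), and define u(t) = sin_{p/2,q}(nπ_{p/2,q}t/T) for t ∈ [0,T]. Then u simultaneously solves two boundary value problems: (i) (φ_p(u'))' + (2q/p*)·(nπ_{p/2,q}/T)^p·φ_q(u)·(1−|u|^q) = 0 on (0,T) with u(0) = u(T) = 0; and (ii) (φ_{p/2}(u'))' + ((p−2)q/p)·(nπ_{p/2,q}/T)^{p/2}·φ_q(u) = 0 on (0,T) with u(0) = u(T) = 0; that is, a solution of the perturbed eigenvalue problem with p-Laplacian is also an eigenfunction of the eigenvalue problem with p/2-Laplacian. -/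

import Mathlib

open Real Set Filter MeasureTheory

/-- Generalized arcsine: `arcsin_{pq}(σ) = ∫_0^σ (1 - s^q)^(-1/p) ds`. -/
noncomputable def arcsinPQ (p q σ : ℝ) : ℝ :=
  ∫ s in (0:ℝ)..σ, (1 - s ^ q) ^ (-(1 / p))

/-- The generalized half-period `π_{pq} = 2 arcsin_{pq}(1)`. -/
noncomputable def piPQ (p q : ℝ) : ℝ := 2 * arcsinPQ p q 1

/-- Generalized incomplete elliptic integral:
`arcsn_{pq}(σ,k) = ∫_0^σ ((1-s^q)(1-k^q s^q))^(-1/p) ds`. -/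
noncomputable def arcsnPQ (p q k σ : ℝ) : ℝ :=
  ∫ s in (0:ℝ)..σ, ((1 - s ^ q) * (1 - k ^ q * s ^ q)) ^ (-(1 / p))

/-- Generalized complete elliptic integral `K_{pq}(k) = arcsn_{pq}(1,k)`. -/
noncomputable def Kpq (p q k : ℝ) : ℝ := arcsnPQ p q k 1

/-- `φ_m(s) = |s|^(m-2) s` for `s ≠ 0`, `φ_m(0) = 0`. -/
noncomputable def phi (m s : ℝ) : ℝ := if s = 0 then 0 else |s| ^ (m - 2) * s

/-- Incomplete beta function `B̃(a,b,u) = ∫_0^u z^(a-1) (1-z)^(b-1) dz`. -/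
noncomputable def incBeta (a b u : ℝ) : ℝ :=
  ∫ z in (0:ℝ)..u, z ^ (a - 1) * (1 - z) ^ (b - 1)

/-- A classical solution of `(φ_p(u'))' + λ φ_q(u) = 0` on `(0,T)` with
`u(0) = u(T) = 0`: `u ∈ C¹([0,T])`, `t ↦ φ_p(u'(t))` is differentiable on `(0,T)`
and the equation holds at every point of `(0,T)`. -/
def IsSolE (p q T lam : ℝ) (u : ℝ → ℝ) : Prop :=
  ∃ u' : ℝ → ℝ,
    (∀ t ∈ Set.Icc 0 T, HasDerivWithinAt u (u' t) (Set.Icc 0 T) t) ∧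
    ContinuousOn u' (Set.Icc 0 T) ∧
    (∀ t ∈ Set.Ioo 0 T, HasDerivWithinAt (fun s => phi p (u' s))
      (-(lam * phi q (u t))) (Set.Ioo 0 T) t) ∧
    u 0 = 0 ∧ u T = 0

/-- A classical solution of `(φ_p(u'))' + λ φ_q(u)(1 - |u|^q) = 0` on `(0,T)` with
`u(0) = u(T) = 0`. -/
def IsSolP (p q T lam : ℝ) (u : ℝ → ℝ) : Prop :=
  ∃ u' : ℝ → ℝ,
    (∀ t ∈ Set.Icc 0 T, HasDerivWithinAt u (u' t) (Set.Icc 0 T) t) ∧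
    ContinuousOn u' (Set.Icc 0 T) ∧
    (∀ t ∈ Set.Ioo 0 T, HasDerivWithinAt (fun s => phi p (u' s))
      (-(lam * phi q (u t) * (1 - |u t| ^ q))) (Set.Ioo 0 T) t) ∧
    u 0 = 0 ∧ u T = 0

/-- `Φ(k) = (1+k^q)^(1/p) (2k^q/(1+k^q))^(1/q - 1/p) K_{pq}(k)`. -/
noncomputable def PhiFun (p q k : ℝ) : ℝ :=
  (1 + k ^ q) ^ (1 / p) * (2 * k ^ q / (1 + k ^ q)) ^ (1 / q - 1 / p) * Kpq p q k

theorem hasDerivWithinAt_of_reflection {F G : ℝ → ℝ} {ε c : ℝ}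
    (hF : ∀ t, F t = ε * F (c - t)) (hG : ∀ t, G t = -ε * G (c - t))
    {s s' : Set ℝ} {x : ℝ} (hs : MapsTo (fun t => c - t) s' s)
    (h : HasDerivWithinAt F (G x) s x) : HasDerivWithinAt F (G (c - x)) s' (c - x) := by
  have h1 : HasDerivWithinAt (fun t : ℝ => c - t) (-1) s' (c - x) :=
    ((hasDerivAt_id (c - x)).const_sub c).hasDerivWithinAt
  have h' : HasDerivWithinAt F (G x) s (c - (c - x)) := by rwa [sub_sub_cancel]
  have h2 := (h'.comp (c - x) h1 hs).const_mul ε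
  have e : (fun t => ε * (F ∘ fun t => c - t) t) = F := funext fun t => (hF t).symm
  rw [e] at h2
  have e' : G (c - x) = ε * (G x * -1) := by
    rw [hG (c - x), sub_sub_cancel]
    ring
  rwa [e']

/-- A derivative on a quarter period propagates to the whole line by reflections. -/
theorem hasDerivAt_of_reflections {F G : ℝ → ℝ} {ε δ h : ℝ} (hh : 0 < h)
    (hF : ∀ t, F t = ε * F (0 - t)) (hG : ∀ t, G t = -ε * G (0 - t))
    (hF' : ∀ t, F t = δ * F (2 * h - t)) (hG' : ∀ t, G t = -δ * G (2 * h - t))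
    (hd : ∀ t ∈ Icc 0 h, HasDerivWithinAt F (G t) (Icc 0 h) t) (t : ℝ) :
    HasDerivAt F (G t) t := by
  let R : ℝ → Prop := fun x => HasDerivWithinAt F (G x) (Ici x) x
  let L : ℝ → Prop := fun x => HasDerivWithinAt F (G x) (Iic x) x
  have mRL (c x : ℝ) : MapsTo (fun t => c - t) (Iic (c - x)) (Ici x) := fun t ht => by
    simp only [mem_Iic, mem_Ici] at *; linarith
  have mLR (c x : ℝ) : MapsTo (fun t => c - t) (Ici (c - x)) (Iic x) := fun t ht => by
    simp only [mem_Iic, mem_Ici] at *; linarith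
  have RL0 (x) (hx : R x) : L (0 - x) := hasDerivWithinAt_of_reflection hF hG (mRL _ _) hx
  have LR0 (x) (hx : L x) : R (0 - x) := hasDerivWithinAt_of_reflection hF hG (mLR _ _) hx
  have RLh (x) (hx : R x) : L (2 * h - x) :=
    hasDerivWithinAt_of_reflection hF' hG' (mRL _ _) hx
  have LRh (x) (hx : L x) : R (2 * h - x) :=
    hasDerivWithinAt_of_reflection hF' hG' (mLR _ _) hx
  have hper : Function.Periodic R (2 * h) := fun x => propext
    ⟨fun hx => by have := LR0 _ (RLh _ hx); ring_nf at this; exact this,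
     fun hx => by
      have := LRh _ (RL0 _ hx)
      rwa [show 2 * h - (0 - x) = x + 2 * h by ring] at this⟩
  have hR0 (x) (hx : x ∈ Ico 0 h) : R x :=
    (hd x ⟨hx.1, hx.2.le⟩).mono_of_mem_nhdsWithin
      (mem_of_superset (Icc_mem_nhdsGE hx.2) (Icc_subset_Icc_left hx.1))
  have hL0 (x) (hx : x ∈ Ioc 0 h) : L x :=
    (hd x ⟨hx.1.le, hx.2⟩).mono_of_mem_nhdsWithin
      (mem_of_superset (Icc_mem_nhdsLE hx.1) (Icc_subset_Icc_right hx.2))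
  have hR (x) : R x := by
    obtain ⟨y, hy, e⟩ := hper.exists_mem_Ico (by linarith) x (-h)
    rw [e]
    rcases lt_or_ge y 0 with h0 | h0
    · have := LR0 (-y) (hL0 _ ⟨by linarith, by linarith [hy.1]⟩)
      rwa [show 0 - -y = y by ring] at this
    · exact hR0 y ⟨h0, by linarith [hy.2]⟩
  have hL : L t := by
    have := RL0 (-t) (hR _)
    rwa [show 0 - -t = t by ring] at this
  have := hL.union (hR t)
  rwa [Iic_union_Ici, hasDerivWithinAt_univ] at this

theorem hasDerivWithinAt_Icc_of_continuousOn {f g : ℝ → ℝ} {a b : ℝ} (hab : a < b)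
    (hf : ContinuousOn f (Icc a b)) (hg : ContinuousOn g (Icc a b))
    (hd : ∀ t ∈ Ioo a b, HasDerivAt f (g t) t) (t : ℝ) (ht : t ∈ Icc a b) :
    HasDerivWithinAt f (g t) (Icc a b) t := by
  have hdiff : DifferentiableOn ℝ f (Ioo a b) := fun x hx =>
    (hd x hx).differentiableAt.differentiableWithinAt
  rcases eq_or_lt_of_le ht.1 with rfl | h1
  · refine (hasDerivWithinAt_Ici_of_tendsto_deriv hdiff
      ((hf a ht).mono Ioo_subset_Icc_self) (Ioo_mem_nhdsGT hab) ?_).mono Icc_subset_Ici_self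
    have h := (hg a ht).mono (Ioo_subset_Icc_self (a := a) (b := b))
    rw [ContinuousWithinAt, nhdsWithin_Ioo_eq_nhdsGT hab] at h
    refine h.congr' ?_
    filter_upwards [Ioo_mem_nhdsGT hab] with x hx using (hd x hx).deriv.symm
  rcases eq_or_lt_of_le ht.2 with rfl | h2
  · refine (hasDerivWithinAt_Iic_of_tendsto_deriv hdiff
      ((hf t ht).mono Ioo_subset_Icc_self) (Ioo_mem_nhdsLT hab) ?_).mono Icc_subset_Iic_self
    have h := (hg t ht).mono (Ioo_subset_Icc_self (a := a) (b := t))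
    rw [ContinuousWithinAt, nhdsWithin_Ioo_eq_nhdsLT hab] at h
    refine h.congr' ?_
    filter_upwards [Ioo_mem_nhdsLT hab] with x hx using (hd x hx).deriv.symm
  · exact (hd t ⟨h1, h2⟩).hasDerivWithinAt

theorem phi_neg (m s : ℝ) : phi m (-s) = -phi m s := by
  unfold phi; by_cases h : s = 0 <;> simp [h]

theorem phi_of_nonneg {m s : ℝ} (hm : 1 < m) (hs : 0 ≤ s) : phi m s = s ^ (m - 1) := by
  unfold phi
  rcases eq_or_lt_of_le hs with rfl | h
  · simp [Real.zero_rpow (by linarith : m - 1 ≠ 0)]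
  · rw [if_neg h.ne', abs_of_pos h, ← Real.rpow_add_one h.ne']; ring_nf

theorem phi_const_mul {m k s : ℝ} (hk : 0 < k) : phi m (k * s) = k ^ (m - 1) * phi m s := by
  unfold phi
  by_cases h : s = 0
  · simp [h]
  · rw [if_neg h, if_neg (mul_ne_zero hk.ne' h), abs_mul, abs_of_pos hk,
      Real.mul_rpow hk.le (abs_nonneg s), show m - 1 = m - 2 + 1 by ring,
      Real.rpow_add_one hk.ne']
    ring

theorem phi_phi {m m' s : ℝ} (hm : 1 < m) (hm' : 1 < m') (h : (m - 1) * (m' - 1) = 1) :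
    phi m' (phi m s) = s := by
  have key (x : ℝ) (hx : 0 ≤ x) : phi m' (phi m x) = x := by
    rw [phi_of_nonneg hm hx, phi_of_nonneg hm' (Real.rpow_nonneg hx _), ← Real.rpow_mul hx, h,
      Real.rpow_one]
  rcases le_total 0 s with hs | hs
  · exact key s hs
  · have := key (-s) (by linarith)
    rw [phi_neg, phi_neg] at this
    linarith

theorem continuous_phi {m : ℝ} (hm : 1 < m) : Continuous (phi m) := by
  have e : phi m = fun s => if 0 ≤ s then |s| ^ (m - 1) else -|s| ^ (m - 1) := by
    ext s
    split_ifs with h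
    · rw [phi_of_nonneg hm h, abs_of_nonneg h]
    · have h := not_le.1 h
      rw [← neg_neg s, phi_neg, phi_of_nonneg hm (by linarith), abs_neg, abs_of_pos (by linarith)]
  rw [e]
  have hc : Continuous fun s : ℝ => |s| ^ (m - 1) :=
    continuous_abs.rpow_const fun _ => Or.inr (by linarith)
  refine Continuous.if_le hc hc.neg continuous_const continuous_id fun s hs => ?_
  simp [← hs, Real.zero_rpow (by linarith : m - 1 ≠ 0)]

theorem intervalIntegrable_arcsinPQ {r q : ℝ} (hr : 1 < r) (hq : 1 < q) :
    IntervalIntegrable (fun s : ℝ => (1 - s ^ q) ^ (-(1 / r))) volume 0 1 := by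
  have hr1 : 1 / r < 1 := by rw [div_lt_one (by linarith)]; exact hr
  have h0 : IntervalIntegrable (fun s : ℝ => s ^ (-(1 / r))) volume 0 1 :=
    intervalIntegral.intervalIntegrable_rpow' (by linarith)
  have h1 : IntervalIntegrable (fun s : ℝ => (1 - s) ^ (-(1 / r))) volume 0 1 := by
    have := (h0.comp_sub_left 1).symm
    simpa using this
  refine h1.mono_fun' (Measurable.aestronglyMeasurable (by fun_prop)) ?_
  rw [uIoc_of_le zero_le_one, EventuallyLE, ae_restrict_iff' measurableSet_Ioc]
  have hne : ∀ᵐ s : ℝ, s ≠ 1 := by simp [ae_iff]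
  filter_upwards [hne] with s h1 hs
  have hs1 : s < 1 := lt_of_le_of_ne hs.2 h1
  have hle : s ^ q ≤ s := by
    simpa using Real.rpow_le_rpow_of_exponent_ge hs.1 hs.2 hq.le
  rw [Real.norm_of_nonneg (Real.rpow_nonneg (by linarith) _)]
  exact Real.rpow_le_rpow_of_nonpos (by linarith) (by linarith)
    (by have : 0 < 1 / r := by positivity
        linarith)

theorem sub_le_arcsinPQ_sub {r q a b : ℝ} (hr : 1 < r) (hq : 1 < q) (ha : 0 ≤ a) (hab : a ≤ b)
    (hb : b ≤ 1) : b - a ≤ arcsinPQ r q b - arcsinPQ r q a := by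
  have hi := intervalIntegrable_arcsinPQ hr hq
  have hsub (c d : ℝ) (hc : c ∈ Icc (0 : ℝ) 1) (hd : d ∈ Icc (0 : ℝ) 1) :
      IntervalIntegrable (fun s : ℝ => (1 - s ^ q) ^ (-(1 / r))) volume c d :=
    hi.mono_set (by rw [uIcc_of_le zero_le_one]; exact uIcc_subset_Icc hc hd)
  have h0 : (0 : ℝ) ∈ Icc (0 : ℝ) 1 := by simp
  have ha' : a ∈ Icc (0 : ℝ) 1 := ⟨ha, hab.trans hb⟩
  have hb' : b ∈ Icc (0 : ℝ) 1 := ⟨ha.trans hab, hb⟩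
  rw [arcsinPQ, arcsinPQ, intervalIntegral.integral_interval_sub_left (hsub _ _ h0 hb')
    (hsub _ _ h0 ha')]
  have : b - a = ∫ _ in a..b, (1 : ℝ) := by simp
  rw [this]
  refine intervalIntegral.integral_mono_on_of_le_Ioo hab (by simp) (hsub _ _ ha' hb')
    fun s hs => ?_
  have hs0 : 0 < s := ha.trans_lt hs.1
  have hs1 : s < 1 := hs.2.trans_le hb
  have := Real.rpow_pos_of_pos hs0 q
  have := Real.rpow_lt_one hs0.le hs1 (by linarith : 0 < q)
  exact Real.one_le_rpow_of_pos_of_le_one_of_nonpos (by linarith) (by linarith)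
    (by have : 0 < 1 / r := by positivity
        linarith)

theorem continuousOn_arcsinPQ {r q : ℝ} (hr : 1 < r) (hq : 1 < q) :
    ContinuousOn (arcsinPQ r q) (Icc 0 1) := by
  have := intervalIntegral.continuousOn_primitive_interval'
    (intervalIntegrable_arcsinPQ hr hq) left_mem_uIcc
  rwa [uIcc_of_le zero_le_one] at this

theorem hasDerivAt_arcsinPQ {r q σ : ℝ} (hr : 1 < r) (hq : 1 < q) (hσ : σ ∈ Ioo (0 : ℝ) 1) :
    HasDerivAt (arcsinPQ r q) ((1 - σ ^ q) ^ (-(1 / r))) σ := by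
  have hi : IntervalIntegrable (fun s : ℝ => (1 - s ^ q) ^ (-(1 / r))) volume 0 σ :=
    (intervalIntegrable_arcsinPQ hr hq).mono_set (by
      rw [uIcc_of_le zero_le_one]; exact uIcc_subset_Icc (by simp) ⟨hσ.1.le, hσ.2.le⟩)
  refine intervalIntegral.integral_hasDerivAt_right hi ?_ ?_
  · exact (Measurable.stronglyMeasurable (by fun_prop)).stronglyMeasurableAtFilter
  · have := Real.rpow_lt_one hσ.1.le hσ.2 (by linarith : 0 < q)
    exact (continuousAt_const.sub (Real.continuousAt_rpow_const _ _ (Or.inl hσ.1.ne'))).rpow_const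
      (Or.inl (sub_pos.2 this).ne')

section InverseFunction

variable {r q : ℝ} {S : ℝ → ℝ}

theorem exists_arcsinPQ_eq (hr : 1 < r) (hq : 1 < q) {t : ℝ}
    (ht : t ∈ Icc 0 (arcsinPQ r q 1)) : ∃ σ ∈ Icc (0 : ℝ) 1, arcsinPQ r q σ = t := by
  have := intermediate_value_Icc zero_le_one (continuousOn_arcsinPQ hr hq)
  rw [show arcsinPQ r q 0 = 0 by simp [arcsinPQ]] at this
  exact this ht

theorem continuousOn_of_leftInverse_arcsinPQ (hr : 1 < r) (hq : 1 < q)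
    (hS : ∀ σ ∈ Icc (0 : ℝ) 1, S (arcsinPQ r q σ) = σ) :
    ContinuousOn S (Icc 0 (arcsinPQ r q 1)) := by
  refine (LipschitzOnWith.of_le_add fun x hx y hy => ?_).continuousOn
  obtain ⟨a, ha, rfl⟩ := exists_arcsinPQ_eq hr hq hx
  obtain ⟨b, hb, rfl⟩ := exists_arcsinPQ_eq hr hq hy
  rw [hS a ha, hS b hb, Real.dist_eq]
  rcases le_total a b with hab | hab
  · linarith [abs_nonneg (arcsinPQ r q a - arcsinPQ r q b)]
  · linarith [sub_le_arcsinPQ_sub hr hq hb.1 hab ha.2,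
      le_abs_self (arcsinPQ r q a - arcsinPQ r q b)]

theorem mapsTo_Icc_of_leftInverse_arcsinPQ (hr : 1 < r) (hq : 1 < q)
    (hS : ∀ σ ∈ Icc (0 : ℝ) 1, S (arcsinPQ r q σ) = σ) {t : ℝ}
    (ht : t ∈ Icc 0 (arcsinPQ r q 1)) : S t ∈ Icc (0 : ℝ) 1 := by
  obtain ⟨a, ha, rfl⟩ := exists_arcsinPQ_eq hr hq ht
  rwa [hS a ha]

theorem mapsTo_Ioo_of_leftInverse_arcsinPQ (hr : 1 < r) (hq : 1 < q)
    (hS : ∀ σ ∈ Icc (0 : ℝ) 1, S (arcsinPQ r q σ) = σ) {t : ℝ}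
    (ht : t ∈ Ioo 0 (arcsinPQ r q 1)) : S t ∈ Ioo (0 : ℝ) 1 := by
  obtain ⟨a, ha, rfl⟩ := exists_arcsinPQ_eq hr hq (Ioo_subset_Icc_self ht)
  rw [hS a ha]
  refine ⟨lt_of_le_of_ne ha.1 ?_, lt_of_le_of_ne ha.2 ?_⟩
  · rintro rfl
    simp [arcsinPQ] at ht
  · rintro rfl
    exact lt_irrefl _ ht.2

theorem hasDerivAt_of_leftInverse_arcsinPQ (hr : 1 < r) (hq : 1 < q)
    (hS : ∀ σ ∈ Icc (0 : ℝ) 1, S (arcsinPQ r q σ) = σ) {t : ℝ}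
    (ht : t ∈ Ioo 0 (arcsinPQ r q 1)) : HasDerivAt S ((1 - S t ^ q) ^ (1 / r)) t := by
  have hSt := mapsTo_Ioo_of_leftInverse_arcsinPQ hr hq hS ht
  have hlt := Real.rpow_lt_one hSt.1.le hSt.2 (by linarith : 0 < q)
  have hpos : 0 < 1 - S t ^ q := by linarith
  have hc : ContinuousAt S t := (continuousOn_of_leftInverse_arcsinPQ hr hq hS).continuousAt
    (Icc_mem_nhds ht.1 ht.2)
  have := (hasDerivAt_arcsinPQ hr hq hSt).of_local_left_inverse hc
    (Real.rpow_pos_of_pos hpos _).ne' (by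
      filter_upwards [Ioo_mem_nhds ht.1 ht.2] with x hx
      obtain ⟨a, ha, rfl⟩ := exists_arcsinPQ_eq hr hq (Ioo_subset_Icc_self hx)
      rw [hS a ha])
  rwa [Real.rpow_neg hpos.le, inv_inv] at this

theorem hasDerivWithinAt_of_leftInverse_arcsinPQ (hr : 1 < r) (hq : 1 < q)
    (hS : ∀ σ ∈ Icc (0 : ℝ) 1, S (arcsinPQ r q σ) = σ) (hh : 0 < arcsinPQ r q 1) {t : ℝ}
    (ht : t ∈ Icc 0 (arcsinPQ r q 1)) :
    HasDerivWithinAt S ((1 - S t ^ q) ^ (1 / r)) (Icc 0 (arcsinPQ r q 1)) t := by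
  have hc := continuousOn_of_leftInverse_arcsinPQ hr hq hS
  refine hasDerivWithinAt_Icc_of_continuousOn (g := fun t => (1 - S t ^ q) ^ (1 / r)) hh hc ?_
    (fun t ht => hasDerivAt_of_leftInverse_arcsinPQ hr hq hS ht) t ht
  exact (continuousOn_const.sub (hc.rpow_const fun _ _ => Or.inr (by linarith))).rpow_const
    fun _ _ => Or.inr (by positivity)

/-- On the quarter period, `φ_m` of the derivative of `S` equals `(1 - S^q)^α` with `α = (m - 1) / r`. -/
theorem hasDerivWithinAt_one_sub_rpow (hr : 1 < r) (hq : 1 < q)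
    (hS : ∀ σ ∈ Icc (0 : ℝ) 1, S (arcsinPQ r q σ) = σ) (hh : 0 < arcsinPQ r q 1) {α : ℝ}
    (hα : 0 < α) (hα' : 0 ≤ α - 1 + 1 / r) {t : ℝ} (ht : t ∈ Icc 0 (arcsinPQ r q 1)) :
    HasDerivWithinAt (fun t => (1 - S t ^ q) ^ α)
      (-(α * q * S t ^ (q - 1) * (1 - S t ^ q) ^ (α - 1 + 1 / r)))
      (Icc 0 (arcsinPQ r q 1)) t := by
  have hc := continuousOn_of_leftInverse_arcsinPQ hr hq hS
  have hc' : ContinuousOn (fun t => 1 - S t ^ q) (Icc 0 (arcsinPQ r q 1)) :=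
    continuousOn_const.sub (hc.rpow_const fun _ _ => Or.inr (by linarith))
  refine hasDerivWithinAt_Icc_of_continuousOn
    (g := fun t => -(α * q * S t ^ (q - 1) * (1 - S t ^ q) ^ (α - 1 + 1 / r))) hh
    (hc'.rpow_const fun _ _ => Or.inr hα.le) ?_ (fun t ht => ?_) t ht
  · exact ((continuousOn_const.mul (hc.rpow_const fun _ _ => Or.inr (by linarith))).mul
      (hc'.rpow_const fun _ _ => Or.inr hα')).neg
  · have hSt := mapsTo_Ioo_of_leftInverse_arcsinPQ hr hq hS ht
    have hlt := Real.rpow_lt_one hSt.1.le hSt.2 (by linarith : 0 < q)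
    have hpos : 0 < 1 - S t ^ q := by linarith
    have hd := (((hasDerivAt_of_leftInverse_arcsinPQ hr hq hS ht).rpow_const (p := q)
      (Or.inl hSt.1.ne')).const_sub 1).rpow_const (p := α) (Or.inl hpos.ne')
    convert hd using 1
    rw [Real.rpow_add hpos]
    ring

end InverseFunction

theorem reflection_of_odd_of_periodic {S : ℝ → ℝ} {P : ℝ} (hP : 0 < P)
    (hrefl : ∀ t ∈ Icc (P / 2) P, S t = S (P - t))
    (hodd : ∀ t, S (-t) = -S t) (hper : ∀ t, S (t + 2 * P) = S t) (t : ℝ) :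
    S (P - t) = S t := by
  have h0 (t) (ht : t ∈ Icc 0 P) : S (P - t) = S t := by
    rcases le_total (P / 2) t with h | h
    · exact (hrefl t ⟨h, ht.2⟩).symm
    · rw [hrefl (P - t) ⟨by linarith, by linarith [ht.1]⟩, sub_sub_cancel]
  have hQ : Function.Periodic (fun t => S (P - t) - S t) (2 * P) := fun t => by
    have := hper (P - (t + 2 * P))
    rw [show P - (t + 2 * P) + 2 * P = P - t by ring] at this
    simp only [hper, this]
  obtain ⟨y, hy, e⟩ := hQ.exists_mem_Ico (by linarith) t (-P)
  rw [← sub_eq_zero, e]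
  rcases le_total 0 y with h | h
  · rw [h0 y ⟨h, by linarith [hy.2]⟩, sub_self]
  · have h1 := hper (-P - y)
    have h2 := h0 (P + y) ⟨by linarith [hy.1], by linarith⟩
    have h3 := hodd (P + y)
    have h4 := hodd y
    rw [show -P - y + 2 * P = P - y by ring] at h1
    rw [show P - (P + y) = -y by ring] at h2
    rw [show -(P + y) = -P - y by ring] at h3
    linarith

/-- A global extension of the quarter-period derivative of `sin_{rq}`. -/
noncomputable def cosPQ (r q : ℝ) (S : ℝ → ℝ) (t : ℝ) : ℝ :=
  (SignType.sign (Real.cos (π * t / piPQ r q)) : ℝ) * (1 - |S t| ^ q) ^ (1 / r)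

theorem cosPQ_of_mem_Icc {r q : ℝ} {S : ℝ → ℝ} (hr : 1 < r) (hq : 1 < q)
    (hS : ∀ σ ∈ Icc (0 : ℝ) 1, S (arcsinPQ r q σ) = σ) (hh : 0 < arcsinPQ r q 1) {t : ℝ}
    (ht : t ∈ Icc 0 (arcsinPQ r q 1)) : cosPQ r q S t = (1 - S t ^ q) ^ (1 / r) := by
  rw [cosPQ, abs_of_nonneg (mapsTo_Icc_of_leftInverse_arcsinPQ hr hq hS ht).1]
  rcases eq_or_lt_of_le ht.2 with rfl | hlt
  · rw [hS 1 (by simp), Real.one_rpow, sub_self, Real.zero_rpow (by positivity), mul_zero]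
  · have : 0 < Real.cos (π * t / piPQ r q) := by
      have hp := Real.pi_pos
      have h1 : π * t / piPQ r q < π / 2 := by
        rw [piPQ, div_lt_div_iff₀ (by positivity) (by positivity)]
        nlinarith
      have h2 : 0 ≤ π * t / piPQ r q :=
        div_nonneg (mul_nonneg hp.le ht.1) (by rw [piPQ]; positivity)
      exact Real.cos_pos_of_mem_Ioo ⟨by linarith, h1⟩
    rw [sign_pos this]
    simp

theorem phi_cosPQ_of_mem_Icc {r q m : ℝ} {S : ℝ → ℝ} (hr : 1 < r) (hq : 1 < q) (hm : 1 < m)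
    (hS : ∀ σ ∈ Icc (0 : ℝ) 1, S (arcsinPQ r q σ) = σ) (hh : 0 < arcsinPQ r q 1) {t : ℝ}
    (ht : t ∈ Icc 0 (arcsinPQ r q 1)) :
    phi m (cosPQ r q S t) = (1 - S t ^ q) ^ ((m - 1) / r) := by
  have hSt := mapsTo_Icc_of_leftInverse_arcsinPQ hr hq hS ht
  have : 0 ≤ 1 - S t ^ q := by
    linarith [Real.rpow_le_one hSt.1 hSt.2 (by linarith : 0 ≤ q)]
  rw [cosPQ_of_mem_Icc hr hq hS hh ht, phi_of_nonneg hm (Real.rpow_nonneg this _),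
    ← Real.rpow_mul this]
  congr 1
  ring

theorem cosPQ_neg {r q : ℝ} {S : ℝ → ℝ} (hodd : ∀ t, S (-t) = -S t) (t : ℝ) :
    cosPQ r q S (-t) = cosPQ r q S t := by
  simp only [cosPQ, hodd, abs_neg]
  rw [show π * -t / piPQ r q = -(π * t / piPQ r q) by ring, Real.cos_neg]

theorem cosPQ_sub {r q : ℝ} {S : ℝ → ℝ} (hP : 0 < piPQ r q)
    (hrefl : ∀ t, S (piPQ r q - t) = S t) (t : ℝ) :
    cosPQ r q S (piPQ r q - t) = -cosPQ r q S t := by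
  simp only [cosPQ, hrefl]
  rw [show π * (piPQ r q - t) / piPQ r q = π - π * t / piPQ r q by field_simp,
    Real.cos_pi_sub, Left.sign_neg]
  simp

theorem arcsinPQ_one_pos {r q : ℝ} (hr : 1 < r) (hq : 1 < q) : 0 < arcsinPQ r q 1 := by
  have := sub_le_arcsinPQ_sub hr hq le_rfl zero_le_one le_rfl
  rw [show arcsinPQ r q 0 = 0 by simp [arcsinPQ]] at this
  linarith

section GlobalDerivatives

variable {r q : ℝ} {S : ℝ → ℝ}

theorem hasDerivAt_sinPQ (hr : 1 < r) (hq : 1 < q)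
    (hS : ∀ σ ∈ Icc (0 : ℝ) 1, S (arcsinPQ r q σ) = σ) (hodd : ∀ t, S (-t) = -S t)
    (hrefl : ∀ t, S (piPQ r q - t) = S t) (t : ℝ) : HasDerivAt S (cosPQ r q S t) t := by
  have hh := arcsinPQ_one_pos hr hq
  have hP : 0 < piPQ r q := by rw [piPQ]; positivity
  refine hasDerivAt_of_reflections (ε := -1) (δ := 1) hh (fun t => ?_) (fun t => ?_)
    (fun t => ?_) (fun t => ?_) (fun t ht => ?_) t
  · rw [zero_sub, hodd]; ring
  · rw [zero_sub, cosPQ_neg hodd]; ring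
  · rw [← piPQ, hrefl]; ring
  · rw [← piPQ, cosPQ_sub hP hrefl]; ring
  · rw [cosPQ_of_mem_Icc hr hq hS hh ht]
    exact hasDerivWithinAt_of_leftInverse_arcsinPQ hr hq hS hh ht

theorem hasDerivAt_phi_cosPQ (hr : 1 < r) (hq : 1 < q)
    (hS : ∀ σ ∈ Icc (0 : ℝ) 1, S (arcsinPQ r q σ) = σ) (hodd : ∀ t, S (-t) = -S t)
    (hrefl : ∀ t, S (piPQ r q - t) = S t) {m : ℝ} (hm : r ≤ m) (t : ℝ) :
    HasDerivAt (fun t => phi m (cosPQ r q S t))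
      (-((m - 1) / r * q * phi q (S t) * (1 - |S t| ^ q) ^ (m / r - 1))) t := by
  have hh := arcsinPQ_one_pos hr hq
  have hP : 0 < piPQ r q := by rw [piPQ]; positivity
  have hm1 : 1 < m := hr.trans_le hm
  have hexp : (m - 1) / r - 1 + 1 / r = m / r - 1 := by ring
  refine hasDerivAt_of_reflections (ε := 1) (δ := -1)
    (G := fun t => -((m - 1) / r * q * phi q (S t) * (1 - |S t| ^ q) ^ (m / r - 1)))
    hh (fun t => ?_) (fun t => ?_) (fun t => ?_) (fun t => ?_) (fun t ht => ?_) t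
  · rw [zero_sub, cosPQ_neg hodd]; ring
  · simp only [zero_sub, hodd, phi_neg, abs_neg]; ring
  · rw [← piPQ, cosPQ_sub hP hrefl, phi_neg]; ring
  · rw [← piPQ, hrefl]; ring
  · have hSt := mapsTo_Icc_of_leftInverse_arcsinPQ hr hq hS ht
    have h1 : 1 ≤ m / r := by rwa [one_le_div (by linarith)]
    have hd := hasDerivWithinAt_one_sub_rpow hr hq hS hh (α := (m - 1) / r)
      (div_pos (by linarith) (by linarith)) (by rw [hexp]; linarith) ht
    rw [hexp] at hd
    simp only [abs_of_nonneg hSt.1, phi_of_nonneg hq hSt.1]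
    exact hd.congr_of_mem (fun t ht => phi_cosPQ_of_mem_Icc hr hq hm1 hS hh ht) ht

theorem continuous_cosPQ (hr : 1 < r) (hq : 1 < q)
    (hS : ∀ σ ∈ Icc (0 : ℝ) 1, S (arcsinPQ r q σ) = σ) (hodd : ∀ t, S (-t) = -S t)
    (hrefl : ∀ t, S (piPQ r q - t) = S t) : Continuous (cosPQ r q S) := by
  have hc : Continuous fun t => phi r (cosPQ r q S t) := continuous_iff_continuousAt.2 fun t =>
    (hasDerivAt_phi_cosPQ hr hq hS hodd hrefl le_rfl t).continuousAt
  have hpos : 0 < r - 1 := by linarith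
  have hr' : 1 < 1 + (r - 1)⁻¹ := by linarith [inv_pos.2 hpos]
  refine ((continuous_phi hr').comp hc).congr fun t => ?_
  exact phi_phi hr hr' (by rw [add_sub_cancel_left]; exact mul_inv_cancel₀ hpos.ne')

end GlobalDerivatives

theorem stmt19 (p q T : ℝ) (hp : 2 < p) (hq : 1 < q) (hT : 0 < T)
    (n : ℕ) (hn : 1 ≤ n)
    (sin2 : ℝ → ℝ)
    (hinv : ∀ σ ∈ Icc (0:ℝ) 1, sin2 (arcsinPQ (p / 2) q σ) = σ)
    (hrefl : ∀ t ∈ Icc (piPQ (p / 2) q / 2) (piPQ (p / 2) q),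
      sin2 t = sin2 (piPQ (p / 2) q - t))
    (hodd : ∀ t : ℝ, sin2 (-t) = - sin2 t)
    (hper : ∀ t : ℝ, sin2 (t + 2 * piPQ (p / 2) q) = sin2 t) :
    let u := fun t : ℝ => sin2 ((n : ℝ) * piPQ (p / 2) q * t / T)
    IsSolP p q T (2 * q / (p / (p - 1)) * ((n : ℝ) * piPQ (p / 2) q / T) ^ p) u ∧
    IsSolE (p / 2) q T ((p - 2) * q / p * ((n : ℝ) * piPQ (p / 2) q / T) ^ (p / 2)) u := by
  intro u
  set r := p / 2 with hr_def
  have hr : 1 < r := by rw [hr_def]; linarith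
  set P := piPQ r q with hP_def
  have hP : 0 < P := by
    have := arcsinPQ_one_pos hr hq
    rw [hP_def, piPQ]; positivity
  have hrefl' := reflection_of_odd_of_periodic hP hrefl hodd hper
  have hS0 : sin2 0 = 0 := by
    have := hodd 0
    rw [neg_zero] at this
    linarith
  have hanti : Function.Antiperiodic sin2 P := fun t => by
    have := hrefl' (-t)
    rw [hodd, sub_neg_eq_add, add_comm] at this
    exact this
  have hn' : (0 : ℝ) < n := by exact_mod_cast hn
  set k : ℝ := n * P / T with hk_def
  have hk : 0 < k := by positivity
  have hu (t : ℝ) : u t = sin2 (k * t) := by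
    simp only [u, hk_def]; congr 1; ring
  have hlin (t : ℝ) : HasDerivAt (fun t => k * t) k t := by
    simpa using (hasDerivAt_id t).const_mul k
  have hdu (t : ℝ) : HasDerivAt u (k * cosPQ r q sin2 (k * t)) t := by
    rw [funext hu]
    have := (hasDerivAt_sinPQ hr hq hinv hodd hrefl' (k * t)).comp t (hlin t)
    rwa [mul_comm] at this
  have hcu : Continuous fun t => k * cosPQ r q sin2 (k * t) :=
    continuous_const.mul ((continuous_cosPQ hr hq hinv hodd hrefl').comp (by fun_prop))
  have hdphi (m : ℝ) (hm : r ≤ m) (t : ℝ) :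
      HasDerivAt (fun t => phi m (k * cosPQ r q sin2 (k * t)))
        (-((m - 1) / r * q * k ^ m * phi q (u t) * (1 - |u t| ^ q) ^ (m / r - 1))) t := by
    simp only [phi_const_mul hk]
    have := ((hasDerivAt_phi_cosPQ hr hq hinv hodd hrefl' hm (k * t)).comp t
      (hlin t)).const_mul (k ^ (m - 1))
    refine this.congr_deriv ?_
    rw [hu, show k ^ m = k ^ (m - 1) * k by rw [← Real.rpow_add_one hk.ne']; ring_nf]
    ring
  have hu0 : u 0 = 0 := by rw [hu, mul_zero, hS0]
  have huT : u T = 0 := by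
    rw [hu, hk_def, div_mul_cancel₀ _ hT.ne']
    exact hanti.nat_mul_eq_of_eq_zero hS0 n
  refine ⟨⟨_, fun t _ => (hdu t).hasDerivWithinAt, hcu.continuousOn, fun t _ => ?_, hu0, huT⟩,
    ⟨_, fun t _ => (hdu t).hasDerivWithinAt, hcu.continuousOn, fun t _ => ?_, hu0, huT⟩⟩
  · have h := hdphi p (by rw [hr_def]; linarith) t
    have e : p / r - 1 = 1 := by rw [hr_def]; field_simp; norm_num
    rw [e, Real.rpow_one] at h
    refine h.hasDerivWithinAt.congr_deriv ?_
    rw [hr_def]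
    field_simp
  · have h := hdphi r le_rfl t
    have e : r / r - 1 = 0 := by rw [div_self (by linarith), sub_self]
    rw [e, Real.rpow_zero] at h
    refine h.hasDerivWithinAt.congr_deriv ?_
    rw [hr_def]
    field_simp
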